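/- arXiv:2311.00431 — 3 statements merged into one kernel-verified Lean document; each statement's English description precedes it below -/
import Mathlib

section
/- Let p be a polynomial with complex coefficients with 2 ≤ p.natDegree, let K be the filled Julia set of the evaluation map, and let J := frontier K be its topological boundary (the Julia set). Then J is totally invariant: (p.eval)⁻¹(J) = J and p.eval '' J = J. (This gives the total invariance of the Julia set J(f) = ∂K(f) used throughout the paper; the proof uses that a nonconstant polynomial is an open map.) -/
open Function

/-- The filled Julia set of a map `g : ℂ → ℂ`: points with bounded forward orbit. -/
def filledJulia (g : ℂ → ℂ) : Set ℂ :=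
  {z : ℂ | ∃ C : ℝ, ∀ n : ℕ, ‖g^[n] z‖ ≤ C}

/-- The filled Julia set of any map is equal to its own preimage. -/
theorem preimage_filledJulia (g : ℂ → ℂ) : g ⁻¹' filledJulia g = filledJulia g := by
  ext z
  constructor
  · rintro ⟨C, hC⟩
    refine ⟨max C ‖z‖, fun n => ?_⟩
    cases n with
    | zero => exact le_max_right _ _
    | succ n => exact (hC n).trans (le_max_left _ _)
  · rintro ⟨C, hC⟩
    exact ⟨C, fun n => hC (n + 1)⟩

/-- The Julia set, i.e. the topological frontier of the filled Julia set, of a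
polynomial of degree at least 2 is totally invariant. -/
theorem juliaSet_totally_invariant (p : Polynomial ℂ) (hp : 2 ≤ p.natDegree) :
    (fun z => p.eval z) ⁻¹' frontier (filledJulia fun z => p.eval z) =
      frontier (filledJulia fun z => p.eval z) ∧
    (fun z => p.eval z) '' frontier (filledJulia fun z => p.eval z) =
      frontier (filledJulia fun z => p.eval z) := by
  have hq : IsOpenQuotientMap fun z => p.eval z := p.isOpenQuotientMap_eval (by omega)
  have hpre : (fun z => p.eval z) ⁻¹' frontier (filledJulia fun z => p.eval z) =
      frontier (filledJulia fun z => p.eval z) := by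
    rw [hq.isOpenMap.preimage_frontier_eq_frontier_preimage hq.continuous, preimage_filledJulia]
  refine ⟨hpre, ?_⟩
  conv_lhs => rw [← hpre]
  exact Set.image_preimage_eq _ hq.surjective
end

section
/- Let p be a polynomial with complex coefficients with 2 ≤ p.natDegree, and let K be the filled Julia set of the evaluation map. Then the complement ℂ \ K is a nonempty open connected set. (Equivalently, the filled Julia set is full: the basin of infinity B_∞(f) = ℂ \ K(f) is connected; the proof uses the maximum modulus principle to rule out bounded complementary components.) -/
open Function

open Set

/-- The boundary of a component of an open set lies outside that set. -/
lemma IsOpen.disjoint_frontier_connectedComponentIn {X : Type*} [TopologicalSpace X]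
    [LocallyConnectedSpace X] {F : Set X} (hF : IsOpen F) (x : X) :
    Disjoint (frontier (connectedComponentIn F x)) F := by
  rw [Set.disjoint_left]
  intro y hy hyF
  obtain ⟨z, hz, hzx⟩ := mem_closure_iff.mp hy.1 _ hF.connectedComponentIn
    (mem_connectedComponentIn hyF)
  refine hy.2 ?_
  rw [hF.connectedComponentIn.interior_eq, connectedComponentIn_eq hzx,
    ← connectedComponentIn_eq hz]
  exact mem_connectedComponentIn hyF

lemma Complex.isConnected_setOf_lt_norm {R : ℝ} (hR : 0 < R) :
    IsConnected {z : ℂ | R < ‖z‖} := by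
  have hexp : Complex.exp '' {z | Real.log R < z.re} = {z : ℂ | R < ‖z‖} := by
    ext w
    simp only [mem_image, mem_ofPred_eq]
    constructor
    · rintro ⟨z, hz, rfl⟩
      rwa [Complex.norm_exp, ← Real.log_lt_iff_lt_exp hR]
    · intro hw
      refine ⟨Complex.log w, ?_, Complex.exp_log (norm_pos_iff.mp (hR.trans hw))⟩
      rw [Complex.log_re]
      exact Real.log_lt_log hR hw
  rw [← hexp]
  refine IsConnected.image ⟨⟨((Real.log R + 1 : ℝ) : ℂ), ?_⟩, ?_⟩ _
    Complex.continuous_exp.continuousOn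
  · rw [mem_ofPred_eq, Complex.ofReal_re]
    exact lt_add_one _
  · exact (convex_halfSpace_re_gt _).isPreconnected

/-- A polynomial of degree at least two has an escape radius. -/
lemma Polynomial.exists_two_mul_norm_le_norm_eval (p : Polynomial ℂ) (hp : 2 ≤ p.natDegree) :
    ∃ R : ℝ, 0 < R ∧ ∀ z : ℂ, R < ‖z‖ → 2 * ‖z‖ ≤ ‖p.eval z‖ := by
  have hdeg : 0 < p.divX.degree := by
    rw [← Polynomial.natDegree_pos_iff_degree_pos,
      Polynomial.natDegree_divX_eq_natDegree_tsub_one]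
    omega
  have hlim := p.divX.tendsto_norm_atTop hdeg tendsto_norm_cobounded_atTop
  obtain ⟨r, -, hr⟩ := (Filter.hasBasis_cobounded_norm (E := ℂ)).mem_iff.mp
    (hlim.eventually_ge_atTop 3)
  refine ⟨max 1 (max r ‖p.coeff 0‖), by positivity, fun z hz ↦ ?_⟩
  simp only [max_lt_iff] at hz
  have h3 : 3 ≤ ‖p.divX.eval z‖ := hr hz.2.1.le
  have heval : p.eval z = p.divX.eval z * z + p.coeff 0 := by
    conv_lhs => rw [← p.divX_mul_X_add]
    simp
  have hnorm := norm_sub_le_norm_add (p.divX.eval z * z) (p.coeff 0)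
  rw [← heval, norm_mul] at hnorm
  nlinarith [norm_nonneg z]

section EscapeRadius

variable {g : ℂ → ℂ} {R : ℝ}

lemma two_pow_mul_norm_le_norm_iterate (hR : 0 < R) (hg : ∀ z, R < ‖z‖ → 2 * ‖z‖ ≤ ‖g z‖)
    {z : ℂ} (hz : R < ‖z‖) (n : ℕ) : 2 ^ n * ‖z‖ ≤ ‖g^[n] z‖ := by
  induction n generalizing z with
  | zero => simp
  | succ n ih =>
    have hgz := hg z hz
    rw [iterate_succ_apply, pow_succ, mul_assoc]
    exact (mul_le_mul_of_nonneg_left hgz (by positivity)).trans (ih (by linarith))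

lemma mem_filledJulia_iff_of_escape (hR : 0 < R) (hg : ∀ z, R < ‖z‖ → 2 * ‖z‖ ≤ ‖g z‖)
    {z : ℂ} : z ∈ filledJulia g ↔ ∀ n : ℕ, ‖g^[n] z‖ ≤ R := by
  refine ⟨fun ⟨C, hC⟩ n ↦ ?_, fun h ↦ ⟨R, h⟩⟩
  by_contra! hn
  obtain ⟨m, hm⟩ := pow_unbounded_of_one_lt (C / R) one_lt_two
  have hgrow := two_pow_mul_norm_le_norm_iterate hR hg hn m
  rw [← iterate_add_apply] at hgrow
  rw [div_lt_iff₀ hR] at hm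
  have := mul_le_mul_of_nonneg_left hn.le (by positivity : (0 : ℝ) ≤ 2 ^ m)
  linarith [hC (m + n)]

lemma setOf_lt_norm_subset_compl_filledJulia (hR : 0 < R)
    (hg : ∀ z, R < ‖z‖ → 2 * ‖z‖ ≤ ‖g z‖) : {z | R < ‖z‖} ⊆ (filledJulia g)ᶜ :=
  fun _ hz hK ↦ ((mem_filledJulia_iff_of_escape hR hg).mp hK 0).not_gt hz

lemma isOpen_compl_filledJulia_of_escape (hR : 0 < R)
    (hg : ∀ z, R < ‖z‖ → 2 * ‖z‖ ≤ ‖g z‖) (hcont : Continuous g) :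
    IsOpen (filledJulia g)ᶜ := by
  have hK : filledJulia g = ⋂ n : ℕ, {z | ‖g^[n] z‖ ≤ R} := by
    ext z
    simp [mem_filledJulia_iff_of_escape hR hg]
  rw [isOpen_compl_iff, hK]
  exact isClosed_iInter fun n ↦ isClosed_le (hcont.iterate n).norm continuous_const

/-- By the maximum modulus principle, every component of the basin of infinity is unbounded. -/
lemma exists_lt_norm_mem_connectedComponentIn_compl_filledJulia (hR : 0 < R)
    (hg : ∀ z, R < ‖z‖ → 2 * ‖z‖ ≤ ‖g z‖) (hd : Differentiable ℂ g) {z : ℂ}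
    (hz : z ∈ (filledJulia g)ᶜ) :
    ∃ w ∈ connectedComponentIn (filledJulia g)ᶜ z, R < ‖w‖ := by
  by_contra! hW
  refine hz ((mem_filledJulia_iff_of_escape hR hg).mpr fun n ↦ ?_)
  refine Complex.norm_le_of_forall_mem_frontier_norm_le (isBounded_iff_forall_norm_le.mpr ⟨R, hW⟩)
    (hd.iterate n).diffContOnCl (fun w hw ↦ ?_) (subset_closure (mem_connectedComponentIn hz))
  have hwK : w ∈ filledJulia g := notMem_compl_iff.mp <| Set.disjoint_left.mp
    ((isOpen_compl_filledJulia_of_escape hR hg hd.continuous).disjoint_frontier_connectedComponentIn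
      z) hw
  exact (mem_filledJulia_iff_of_escape hR hg).mp hwK n

lemma isConnected_compl_filledJulia_of_escape (hR : 0 < R)
    (hg : ∀ z, R < ‖z‖ → 2 * ‖z‖ ≤ ‖g z‖) (hd : Differentiable ℂ g) :
    IsConnected (filledJulia g)ᶜ := by
  have hV := Complex.isConnected_setOf_lt_norm hR
  have hVK := setOf_lt_norm_subset_compl_filledJulia hR hg
  obtain ⟨x, hx⟩ := hV.nonempty
  refine ⟨⟨x, hVK hx⟩, isPreconnected_of_forall x fun y hy ↦ ?_⟩
  obtain ⟨w, hwy, hw⟩ :=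
    exists_lt_norm_mem_connectedComponentIn_compl_filledJulia hR hg hd hy
  exact ⟨_, union_subset hVK (connectedComponentIn_subset _ y), .inl hx,
    .inr (mem_connectedComponentIn hy),
    hV.isPreconnected.union w hw hwy isPreconnected_connectedComponentIn⟩

end EscapeRadius

/-- The basin of infinity (complement of the filled Julia set) of a polynomial of
degree at least 2 is a nonempty open connected set. -/
theorem basin_of_infinity_open_connected (p : Polynomial ℂ) (hp : 2 ≤ p.natDegree) :
    (filledJulia fun z => p.eval z)ᶜ.Nonempty ∧
    IsOpen (filledJulia fun z => p.eval z)ᶜ ∧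
    IsConnected (filledJulia fun z => p.eval z)ᶜ := by
  obtain ⟨R, hR, hg⟩ := p.exists_two_mul_norm_le_norm_eval hp
  have hconn := isConnected_compl_filledJulia_of_escape hR hg p.differentiable
  exact ⟨hconn.nonempty, isOpen_compl_filledJulia_of_escape hR hg p.continuous, hconn⟩
end

section
/- Let a : ℕ → ℕ with 1 ≤ a(n) for all n, and let q : ℕ → ℕ satisfy q(0) = 1, 1 ≤ q(1), and q(n) = a(n−1)·q(n−1) + q(n−2) for all n ≥ 2. Set r(n) := q(n) + q(n+1) and 𝐫(n) := Σ_{i=1}^{n} r(i). Then for all n ≥ 3: q(n+2) ≥ r(n) and r(n) > 𝐫(n−2). (This is Lemma 6.5 of the paper on continued-fraction denominators, used to control return times of puzzle disks.) -/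
/-- Lemma 6.5 of the paper: with `q` the continued-fraction denominators,
`r n = q n + q (n+1)` and `𝐫 n = ∑_{i=1}^n r i`, one has for all `n ≥ 3`
that `q (n+2) ≥ r n` and `r n > 𝐫 (n−2)`. -/
theorem cf_denominator_return_times (a q : ℕ → ℕ)
    (ha : ∀ n, 1 ≤ a n)
    (hq0 : q 0 = 1) (hq1 : 1 ≤ q 1)
    (hrec : ∀ n, 2 ≤ n → q n = a (n - 1) * q (n - 1) + q (n - 2)) :
    ∀ n, 3 ≤ n →
      (q n + q (n + 1) ≤ q (n + 2)) ∧
      (∑ i ∈ Finset.Icc 1 (n - 2), (q i + q (i + 1))) < q n + q (n + 1) := by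
  have step (n : ℕ) : q n + q (n + 1) ≤ q (n + 2) := by
    have h := hrec (n + 2) (by omega)
    simp only [Nat.add_sub_cancel, show n + 2 - 1 = n + 1 by omega] at h
    have := Nat.le_mul_of_pos_left (q (n + 1)) (ha (n + 1))
    omega
  have sum_lt (m : ℕ) :
      ∑ i ∈ Finset.Icc 1 m, (q i + q (i + 1)) < q (m + 2) + q (m + 3) := by
    induction m with
    | zero =>
      have h₀ := step 0
      simp only [Nat.zero_add] at h₀ ⊢
      simp
      omega
    | succ m ih =>
      rw [Finset.sum_Icc_succ_top (by omega)]
      have h₁ := step (m + 1)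
      have h₂ := step (m + 2)
      simp only [Nat.add_assoc, Nat.reduceAdd] at h₁ h₂ ⊢
      omega
  intro n hn
  obtain ⟨m, rfl⟩ := Nat.exists_eq_add_of_le' (show 2 ≤ n by omega)
  exact ⟨step _, sum_lt m⟩
end
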